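/- Let h : ℝ^d → ℝ be a bounded C¹ function satisfying the weak resolvent identity. Then for every compactly supported Lipschitz function u : ℝ^d → [0,1] one has the Caccioppoli-type estimate ∫_{ℝ^d} u² h² dμ + (1/4)∫_{ℝ^d} Φ_A ‖∇h‖² u² dμ ≤ 2d ∫_{ℝ^d} |A|_∞ ‖∇u‖² h² dμ + 2d² ∫_{ℝ^d} |C|_∞² Φ_A⁻¹ ‖∇u‖² h² dμ + ∫_{ℝ^d} ‖B̄‖ ‖∇u‖ h² u dμ, the inequality being understood in [0,∞]. -/

import Mathlib

open MeasureTheory Real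
open scoped RealInnerProductSpace ENNReal

noncomputable section

/-- `⟨M v, w⟩` for a `d × d` matrix `M` and vectors `v, w ∈ ℝ^d`. -/
def mdot {d : ℕ} (M : Matrix (Fin d) (Fin d) ℝ) (v w : EuclideanSpace ℝ (Fin d)) : ℝ :=
  ∑ i, ∑ j, M i j * v j * w i

/-- `|M|_∞ = max_{i,j} |m_ij|`. -/
def matSup {d : ℕ} (M : Matrix (Fin d) (Fin d) ℝ) : ℝ :=
  ⨆ i, ⨆ j, |M i j|

/-- `Φ_M = inf_{ξ ≠ 0} ⟨M ξ, ξ⟩ / ‖ξ‖²`. -/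
def PhiA {d : ℕ} (M : Matrix (Fin d) (Fin d) ℝ) : ℝ :=
  ⨅ ξ : {ξ : EuclideanSpace ℝ (Fin d) // ξ ≠ 0}, mdot M ξ.1 ξ.1 / ‖ξ.1‖ ^ 2

/-- `h` satisfies the weak resolvent identity:
`(1/2)∫ ⟨(A+C)∇u, ∇h⟩ dμ + ∫ ⟨B̄, ∇u⟩ h dμ + ∫ u h dμ = 0` for every compactly supported
Lipschitz `u`. -/
def WeakResolvent {d : ℕ} (μ : Measure (EuclideanSpace ℝ (Fin d)))
    (A C : EuclideanSpace ℝ (Fin d) → Matrix (Fin d) (Fin d) ℝ)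
    (Bb : EuclideanSpace ℝ (Fin d) → EuclideanSpace ℝ (Fin d))
    (h : EuclideanSpace ℝ (Fin d) → ℝ) : Prop :=
  ∀ u : EuclideanSpace ℝ (Fin d) → ℝ,
    (∃ K, LipschitzWith K u) → HasCompactSupport u →
    (1/2) * (∫ x, mdot (A x + C x) (gradient u x) (gradient h x) ∂μ)
      + (∫ x, ⟪Bb x, gradient u x⟫ * h x ∂μ)
      + (∫ x, u x * h x ∂μ) = 0


theorem mdot_add_left {d : ℕ} (M N : Matrix (Fin d) (Fin d) ℝ) (v w : EuclideanSpace ℝ (Fin d)) :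
    mdot (M + N) v w = mdot M v w + mdot N v w := by
  simp only [mdot, Matrix.add_apply, add_mul, Finset.sum_add_distrib]

theorem mdot_smul_add_smul {d : ℕ} (M : Matrix (Fin d) (Fin d) ℝ) (a b : ℝ)
    (v₁ v₂ w : EuclideanSpace ℝ (Fin d)) :
    mdot M (a • v₁ + b • v₂) w = a * mdot M v₁ w + b * mdot M v₂ w := by
  simp only [mdot, PiLp.add_apply, PiLp.smul_apply, smul_eq_mul, Finset.mul_sum,
    ← Finset.sum_add_distrib]
  exact Finset.sum_congr rfl fun i _ => Finset.sum_congr rfl fun j _ => by ring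

theorem mdot_transpose {d : ℕ} (M : Matrix (Fin d) (Fin d) ℝ) (v w : EuclideanSpace ℝ (Fin d)) :
    mdot M.transpose v w = mdot M w v := by
  simp only [mdot, Matrix.transpose_apply]
  rw [Finset.sum_comm]
  exact Finset.sum_congr rfl fun i _ => Finset.sum_congr rfl fun j _ => by ring

theorem mdot_self_eq_zero {d : ℕ} {M : Matrix (Fin d) (Fin d) ℝ} (hM : M.transpose = -M)
    (v : EuclideanSpace ℝ (Fin d)) : mdot M v v = 0 := by
  have h₁ := mdot_transpose M v v
  have h₂ : mdot (-M) v v = -mdot M v v := by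
    simp [mdot, Finset.sum_neg_distrib]
  rw [hM, h₂] at h₁
  linarith

theorem abs_le_matSup {d : ℕ} (M : Matrix (Fin d) (Fin d) ℝ) (i j : Fin d) :
    |M i j| ≤ matSup M :=
  (le_ciSup (f := fun j => |M i j|) (Set.finite_range _).bddAbove j).trans
    (le_ciSup (f := fun i => ⨆ j, |M i j|) (Set.finite_range _).bddAbove i)

theorem matSup_nonneg {d : ℕ} (M : Matrix (Fin d) (Fin d) ℝ) : 0 ≤ matSup M :=
  Real.iSup_nonneg fun _ => Real.iSup_nonneg fun _ => abs_nonneg _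

theorem sum_abs_le_sqrt_mul_norm {d : ℕ} (v : EuclideanSpace ℝ (Fin d)) :
    ∑ i, |v i| ≤ √d * ‖v‖ := by
  rw [EuclideanSpace.norm_eq, ← Real.sqrt_mul (Nat.cast_nonneg d)]
  refine Real.le_sqrt_of_sq_le ?_
  simpa using sq_sum_le_card_mul_sum_sq (s := Finset.univ) (f := fun i => |v i|)

theorem abs_mdot_le {d : ℕ} (M : Matrix (Fin d) (Fin d) ℝ) (v w : EuclideanSpace ℝ (Fin d)) :
    |mdot M v w| ≤ d * matSup M * (‖v‖ * ‖w‖) := by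
  have h₁ : |mdot M v w| ≤ matSup M * ((∑ j, |v j|) * ∑ i, |w i|) := by
    rw [mul_comm (∑ j, |v j|), Finset.sum_mul_sum, Finset.mul_sum]
    refine (Finset.abs_sum_le_sum_abs _ _).trans (Finset.sum_le_sum fun i _ => ?_)
    rw [Finset.mul_sum]
    refine (Finset.abs_sum_le_sum_abs _ _).trans (Finset.sum_le_sum fun j _ => ?_)
    rw [abs_mul, abs_mul, mul_assoc, mul_comm |w i|]
    exact mul_le_mul_of_nonneg_right (abs_le_matSup M i j) (by positivity)
  have h₂ : (∑ j, |v j|) * ∑ i, |w i| ≤ (√d * ‖v‖) * (√d * ‖w‖) :=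
    mul_le_mul (sum_abs_le_sqrt_mul_norm v) (sum_abs_le_sqrt_mul_norm w)
      (by positivity) (by positivity)
  calc |mdot M v w| ≤ matSup M * ((√d * ‖v‖) * (√d * ‖w‖)) :=
        h₁.trans (mul_le_mul_of_nonneg_left h₂ (matSup_nonneg M))
    _ = (√d * √d) * matSup M * (‖v‖ * ‖w‖) := by ring
    _ = d * matSup M * (‖v‖ * ‖w‖) := by rw [Real.mul_self_sqrt (Nat.cast_nonneg d)]

theorem mdot_self_pos {d : ℕ} {M : Matrix (Fin d) (Fin d) ℝ} (hM : M.PosDef)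
    {v : EuclideanSpace ℝ (Fin d)} (hv : v ≠ 0) : 0 < mdot M v v := by
  have hv' : (fun i => v i) ≠ 0 := fun h => hv (by ext i; exact congrFun h i)
  have := hM.dotProduct_mulVec_pos hv'
  refine this.trans_eq ?_
  simp only [mdot, dotProduct, Matrix.mulVec, Finset.mul_sum, Pi.star_apply, star_trivial]
  exact Finset.sum_congr rfl fun i _ => Finset.sum_congr rfl fun j _ => by ring

theorem mdot_self_nonneg {d : ℕ} {M : Matrix (Fin d) (Fin d) ℝ} (hM : M.PosDef)
    (v : EuclideanSpace ℝ (Fin d)) : 0 ≤ mdot M v v := by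
  rcases eq_or_ne v 0 with rfl | hv
  · simp [mdot]
  · exact (mdot_self_pos hM hv).le

theorem PhiA_mul_norm_sq_le {d : ℕ} {M : Matrix (Fin d) (Fin d) ℝ} (hM : M.PosDef)
    (v : EuclideanSpace ℝ (Fin d)) : PhiA M * ‖v‖ ^ 2 ≤ mdot M v v := by
  rcases eq_or_ne v 0 with rfl | hv
  · simp [mdot]
  · rw [← le_div_iff₀ (by positivity)]
    refine ciInf_le (f := fun ξ : {ξ : EuclideanSpace ℝ (Fin d) // ξ ≠ 0} =>
      mdot M ξ.1 ξ.1 / ‖ξ.1‖ ^ 2) ⟨0, ?_⟩ ⟨v, hv⟩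
    rintro _ ⟨ξ, rfl⟩
    exact div_nonneg (mdot_self_nonneg hM _) (by positivity)

theorem PhiA_pos {d : ℕ} (hd : 0 < d) {M : Matrix (Fin d) (Fin d) ℝ} (hM : M.PosDef) :
    0 < PhiA M := by
  have : Nonempty (Fin d) := ⟨⟨0, hd⟩⟩
  obtain ⟨e, he⟩ := exists_ne (0 : EuclideanSpace ℝ (Fin d))
  have : Nonempty {ξ : EuclideanSpace ℝ (Fin d) // ξ ≠ 0} := ⟨⟨e, he⟩⟩
  have hcont : Continuous fun v : EuclideanSpace ℝ (Fin d) => mdot M v v := by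
    unfold mdot; fun_prop
  obtain ⟨z, hz, hmin⟩ := (isCompact_sphere (0 : EuclideanSpace ℝ (Fin d)) 1).exists_isMinOn
    (NormedSpace.sphere_nonempty.2 zero_le_one) hcont.continuousOn
  have hz0 : z ≠ 0 := ne_zero_of_mem_unit_sphere ⟨z, hz⟩
  refine (mdot_self_pos hM hz0).trans_le (le_ciInf fun ξ => ?_)
  have hξ : 0 < ‖ξ.1‖ := norm_pos_iff.2 ξ.2
  have hmem : ‖ξ.1‖⁻¹ • ξ.1 ∈ Metric.sphere (0 : EuclideanSpace ℝ (Fin d)) 1 := by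
    simp [norm_smul, hξ.ne']
  refine (hmin hmem).trans_eq ?_
  simp only [mdot, PiLp.smul_apply, smul_eq_mul, Finset.sum_div]
  refine Finset.sum_congr rfl fun i _ => Finset.sum_congr rfl fun j _ => ?_
  field_simp

/-- The pointwise inequality behind the Caccioppoli estimate. -/
theorem caccioppoli_pointwise {d : ℕ} (hd : 0 < d) {A C : Matrix (Fin d) (Fin d) ℝ}
    (hAsymm : A.IsSymm) (hApos : A.PosDef) (hC : C.transpose = -C)
    (b p q : EuclideanSpace ℝ (Fin d)) {s : ℝ} (hs : 0 ≤ s) (t : ℝ) :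
    s ^ 2 * t ^ 2 + 1 / 4 * (PhiA A * ‖q‖ ^ 2 * s ^ 2) ≤
      (1 / 2 * mdot (A + C) ((2 * s * t) • p + (s ^ 2) • q) q
        + ⟪b, (2 * s * t) • p + (s ^ 2) • q⟫ * t + s * s * t * t
        - 1 / 2 * ⟪b, (2 * s * t ^ 2) • p + (2 * s ^ 2 * t) • q⟫)
      + (2 * d * (matSup A * ‖p‖ ^ 2 * t ^ 2)
        + 2 * d ^ 2 * (matSup C ^ 2 * (PhiA A)⁻¹ * ‖p‖ ^ 2 * t ^ 2)
        + ‖b‖ * ‖p‖ * t ^ 2 * s) := by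
  have hΦ := PhiA_pos hd hApos
  have hcoer := PhiA_mul_norm_sq_le hApos q
  have hApp : mdot A p p ≤ d * matSup A * (‖p‖ * ‖p‖) := (le_abs_self _).trans (abs_mdot_le A p p)
  have hb := abs_le.1 (abs_real_inner_le_norm b p)
  have hAqp : mdot A q p = mdot A p q := by rw [← mdot_transpose A q p, hAsymm.eq]
  have hAsq : 0 ≤ s ^ 2 * mdot A q q + 8 * (s * t) * mdot A p q + 16 * t ^ 2 * mdot A p p := by
    have := mdot_self_nonneg hApos (s • q + (4 * t) • p)
    have hsymm : ∀ v w, mdot A v w = mdot A w v := fun v w => by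
      rw [← mdot_transpose A v w, hAsymm.eq]
    rw [mdot_smul_add_smul, hsymm q, hsymm p, mdot_smul_add_smul, mdot_smul_add_smul, hAqp] at this
    linarith
  have hCterm : -(s * t * mdot C p q) ≤ 1 / 8 * (s ^ 2 * (PhiA A * ‖q‖ ^ 2))
      + 2 * d ^ 2 * (matSup C ^ 2 * (PhiA A)⁻¹ * ‖p‖ ^ 2 * t ^ 2) := by
    have h₁ : -(s * t * mdot C p q) ≤ s * |t| * (d * matSup C * (‖p‖ * ‖q‖)) := by
      refine (neg_le_abs _).trans ?_
      rw [abs_mul, abs_mul, abs_of_nonneg hs]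
      exact mul_le_mul_of_nonneg_left (abs_mdot_le C p q) (by positivity)
    have h₂ : 0 ≤ 1 / 8 * (PhiA A)⁻¹ *
        (s * PhiA A * ‖q‖ - 4 * |t| * d * matSup C * ‖p‖) ^ 2 := by positivity
    have h₃ : 1 / 8 * (PhiA A)⁻¹ * (s * PhiA A * ‖q‖ - 4 * |t| * d * matSup C * ‖p‖) ^ 2
        = 1 / 8 * (s ^ 2 * (PhiA A * ‖q‖ ^ 2))
          + 2 * d ^ 2 * (matSup C ^ 2 * (PhiA A)⁻¹ * ‖p‖ ^ 2 * |t| ^ 2)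
          - s * |t| * (d * matSup C * (‖p‖ * ‖q‖)) := by
      field_simp
      ring
    rw [sq_abs] at h₃
    linarith
  have hBterm : -(s * t ^ 2 * ⟪b, p⟫) ≤ ‖b‖ * ‖p‖ * t ^ 2 * s := by
    nlinarith [mul_nonneg hs (sq_nonneg t)]
  rw [mdot_smul_add_smul, mdot_add_left, mdot_add_left, mdot_self_eq_zero hC]
  simp only [inner_add_right, inner_smul_right]
  have h₄ := mul_le_mul_of_nonneg_left hApp (sq_nonneg t)
  have h₅ := mul_le_mul_of_nonneg_left hcoer (sq_nonneg s)
  nlinarith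

theorem LipschitzWith.exists_mul_of_hasCompactSupport {E : Type*} [PseudoMetricSpace E]
    {f g : E → ℝ} {K : NNReal} (hf : LipschitzWith K f) (hfc : HasCompactSupport f)
    (hg : LocallyLipschitz g) : ∃ K', LipschitzWith K' fun x => f x * g x := by
  obtain ⟨L, hL⟩ := (hg.locallyLipschitzOn (s := tsupport f)).exists_lipschitzOnWith_of_compact hfc
  obtain ⟨M, hM⟩ := hfc.exists_bound_of_continuous hf.continuous
  obtain ⟨N, hN⟩ := IsCompact.exists_bound_of_continuousOn hfc hg.continuous.continuousOn
  have key : ∀ x y, x ∈ tsupport f →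
      dist (f x * g x) (f y * g y) ≤ (K * max N 0 + max M 0 * L) * dist x y := by
    intro x y hx
    have hK := hf.dist_le_mul x y
    have hgx : |g x| ≤ max N 0 := (hN x hx).trans (le_max_left _ _)
    have hfy : |f y| ≤ max M 0 := (hM y).trans (le_max_left _ _)
    have h₁ : |f x - f y| * |g x| ≤ K * dist x y * max N 0 :=
      mul_le_mul hK hgx (abs_nonneg _) (by positivity)
    have h₂ : |f y| * |g x - g y| ≤ max M 0 * (L * dist x y) := by
      by_cases hy : y ∈ tsupport f
      · exact mul_le_mul hfy (hL.dist_le_mul x hx y hy) (abs_nonneg _) (by positivity)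
      · rw [image_eq_zero_of_notMem_tsupport hy, abs_zero, zero_mul]
        positivity
    calc dist (f x * g x) (f y * g y) = |(f x - f y) * g x + f y * (g x - g y)| := by
          rw [Real.dist_eq]; ring_nf
      _ ≤ |f x - f y| * |g x| + |f y| * |g x - g y| := by
          simpa only [abs_mul] using abs_add_le ((f x - f y) * g x) (f y * (g x - g y))
      _ ≤ _ := by linarith
  refine ⟨Real.toNNReal (K * max N 0 + max M 0 * L), LipschitzWith.of_dist_le_mul fun x y => ?_⟩
  rw [Real.coe_toNNReal _ (by positivity)]
  by_cases hx : x ∈ tsupport f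
  · exact key x y hx
  by_cases hy : y ∈ tsupport f
  · simpa only [dist_comm] using key y x hy
  · rw [image_eq_zero_of_notMem_tsupport hx, image_eq_zero_of_notMem_tsupport hy]
    simp only [zero_mul, dist_self]
    positivity

theorem MeasureTheory.LocallyIntegrable.integrable_mul_of_bounded {X : Type*} [TopologicalSpace X]
    [T2Space X] [MeasurableSpace X] [OpensMeasurableSpace X] {μ : Measure X} {f g : X → ℝ}
    (hf : LocallyIntegrable f μ) (hg : Measurable g) (hgc : HasCompactSupport g) {c : ℝ}
    (hgb : ∀ x, |g x| ≤ c) : Integrable (fun x => f x * g x) μ := by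
  have h₁ : Integrable ((tsupport g).indicator fun x => f x * g x) μ := by
    rw [integrable_indicator_iff (isClosed_tsupport g).measurableSet]
    exact Integrable.mul_bdd (hf.integrableOn_isCompact hgc) hg.aestronglyMeasurable
      (Filter.Eventually.of_forall hgb)
  rwa [Set.indicator_eq_self.2] at h₁
  exact (Function.support_mul_subset_right f g).trans (subset_tsupport g)

section Gradient

variable {E : Type*} [NormedAddCommGroup E] [InnerProductSpace ℝ E] [CompleteSpace E]

theorem HasGradientAt.mul_real {f g : E → ℝ} {f' g' : E} {x : E} (hf : HasGradientAt f f' x)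
    (hg : HasGradientAt g g' x) :
    HasGradientAt (fun y => f y * g y) (f x • g' + g x • f') x := by
  rw [hasGradientAt_iff_hasFDerivAt] at *
  rw [map_add, map_smul, map_smul]
  exact hf.mul hg

theorem norm_gradient_eq_norm_fderiv (f : E → ℝ) (x : E) : ‖gradient f x‖ = ‖fderiv ℝ f x‖ := by
  rw [← toDual_gradient, LinearIsometryEquiv.norm_map]

theorem measurable_gradient [MeasurableSpace E] [BorelSpace E] (f : E → ℝ) :
    Measurable (gradient f) :=
  (InnerProductSpace.toDual ℝ E).symm.continuous.measurable.comp (measurable_fderiv ℝ f)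

theorem ContDiff.continuous_gradient {f : E → ℝ} (hf : ContDiff ℝ 1 f) :
    Continuous (gradient f) :=
  (InnerProductSpace.toDual ℝ E).symm.continuous.comp (hf.continuous_fderiv one_ne_zero)

theorem HasCompactSupport.gradient {f : E → ℝ} (hf : HasCompactSupport f) :
    HasCompactSupport (gradient f) :=
  (hf.fderiv ℝ).comp_left (map_zero _)

end Gradient

/-- If `∫ e = 0` and `G ≤ e + R` then `∫⁻ G ≤ ∫⁻ R`, without any measurability of `G` and `R`. -/
theorem lintegral_ofReal_le_of_integral_eq_zero {X : Type*} [MeasurableSpace X] {μ : Measure X}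
    {e G R : X → ℝ} (he : Integrable e μ) (he0 : ∫ x, e x ∂μ = 0) (hG : ∀ x, 0 ≤ G x)
    (hR : ∀ x, 0 ≤ R x) (hle : ∀ᵐ x ∂μ, G x ≤ e x + R x) :
    ∫⁻ x, ENNReal.ofReal (G x) ∂μ ≤ ∫⁻ x, ENNReal.ofReal (R x) ∂μ := by
  have hpos : ∫⁻ x, ENNReal.ofReal (e x) ∂μ ≠ ∞ := he.lintegral_lt_top.ne
  have hneg : ∫⁻ x, ENNReal.ofReal (-e x) ∂μ ≠ ∞ := he.neg.lintegral_lt_top.ne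
  have heq : ∫⁻ x, ENNReal.ofReal (e x) ∂μ = ∫⁻ x, ENNReal.ofReal (-e x) ∂μ := by
    rw [integral_eq_lintegral_pos_part_sub_lintegral_neg_part he, sub_eq_zero] at he0
    exact (ENNReal.toReal_eq_toReal_iff' hpos hneg).1 he0
  have hmeas := he.aestronglyMeasurable.aemeasurable
  have hsum : ∫⁻ x, (ENNReal.ofReal (-e x) + ENNReal.ofReal (G x)) ∂μ
      ≤ ∫⁻ x, (ENNReal.ofReal (e x) + ENNReal.ofReal (R x)) ∂μ := by
    refine lintegral_mono_ae (hle.mono fun x hx => ?_)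
    rcases le_total 0 (e x) with h0 | h0
    · rw [ENNReal.ofReal_of_nonpos (neg_nonpos.2 h0), zero_add, ← ENNReal.ofReal_add h0 (hR x)]
      exact ENNReal.ofReal_le_ofReal hx
    · rw [ENNReal.ofReal_of_nonpos h0, zero_add, ← ENNReal.ofReal_add (neg_nonneg.2 h0) (hG x)]
      exact ENNReal.ofReal_le_ofReal (by linarith)
  rw [lintegral_add_left' (f := fun x => ENNReal.ofReal (-e x)) hmeas.neg.ennreal_ofReal,
    lintegral_add_left' hmeas.ennreal_ofReal, heq] at hsum
  exact (ENNReal.add_le_add_iff_left hneg).1 hsum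

theorem measurable_matSup {X : Type*} [MeasurableSpace X] {d : ℕ}
    {M : X → Matrix (Fin d) (Fin d) ℝ} (hM : ∀ i j, Measurable fun x => M x i j) :
    Measurable fun x => matSup (M x) :=
  Measurable.iSup fun i => Measurable.iSup fun j => (hM i j).norm

theorem integrable_mdot_gradient {d : ℕ} {μ : Measure (EuclideanSpace ℝ (Fin d))}
    [IsLocallyFiniteMeasure μ] {M : EuclideanSpace ℝ (Fin d) → Matrix (Fin d) (Fin d) ℝ}
    (hM : ∀ i j, Continuous fun x => M x i j) {f g : EuclideanSpace ℝ (Fin d) → ℝ}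
    {K : NNReal} (hf : LipschitzWith K f) (hfc : HasCompactSupport f) (hg : ContDiff ℝ 1 g) :
    Integrable (fun x => mdot (M x) (gradient f x) (gradient g x)) μ := by
  refine integrable_finsetSum _ fun i _ => integrable_finsetSum _ fun j _ => ?_
  have hcont : Continuous fun x => M x i j * gradient g x i :=
    (hM i j).mul ((EuclideanSpace.proj (𝕜 := ℝ) i).continuous.comp hg.continuous_gradient)
  have hsupp : HasCompactSupport fun x => gradient f x j :=
    hfc.gradient.comp_left (g := fun v : EuclideanSpace ℝ (Fin d) => v j) rfl
  have hmeas : Measurable fun x => gradient f x j :=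
    (EuclideanSpace.proj (𝕜 := ℝ) j).continuous.measurable.comp (measurable_gradient f)
  refine (hcont.locallyIntegrable.integrable_mul_of_bounded hmeas hsupp (c := K)
    fun x => ?_).congr (Filter.Eventually.of_forall fun x => by ring)
  refine (PiLp.norm_apply_le (gradient f x) j).trans ?_
  rw [norm_gradient_eq_norm_fderiv]
  exact norm_fderiv_le_of_lipschitz ℝ hf

theorem integrable_inner_gradient_mul {E : Type*} [NormedAddCommGroup E] [InnerProductSpace ℝ E]
    [FiniteDimensional ℝ E] [MeasurableSpace E] [BorelSpace E] {μ : Measure E} {B : E → E}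
    (hB : Measurable B) (hBloc : LocallyIntegrable (fun x => ‖B x‖) μ) {f k : E → ℝ} {K : NNReal}
    (hf : LipschitzWith K f) (hfc : HasCompactSupport f) (hk : Measurable k) {c : ℝ}
    (hkc : ∀ x, |k x| ≤ c) : Integrable (fun x => ⟪B x, gradient f x⟫ * k x) μ := by
  have hmeas := measurable_gradient f
  have hsupp : HasCompactSupport fun x => ‖gradient f x‖ * |k x| := hfc.gradient.norm.mul_right
  have hmeas' : Measurable fun x => ‖gradient f x‖ * |k x| := hmeas.norm.mul hk.norm
  refine (hBloc.integrable_mul_of_bounded hmeas' hsupp (c := K * c)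
    fun x => ?_).mono' ((hB.inner hmeas).mul hk).aestronglyMeasurable
    (Filter.Eventually.of_forall fun x => ?_)
  · rw [abs_of_nonneg (by positivity), norm_gradient_eq_norm_fderiv]
    exact mul_le_mul (norm_fderiv_le_of_lipschitz ℝ hf) (hkc x) (abs_nonneg _) K.2
  · rw [norm_mul, Real.norm_eq_abs (k x), ← mul_assoc]
    exact mul_le_mul_of_nonneg_right (abs_real_inner_le_norm _ _) (abs_nonneg _)

/-- The Caccioppoli-type estimate (3.4) from the proof of Theorem 3.1: for a bounded `C¹`
function `h` satisfying the weak resolvent identity and any compactly supported Lipschitz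
`u : ℝ^d → [0,1]`,
`∫ u²h² dμ + (1/4)∫ Φ_A ‖∇h‖² u² dμ
  ≤ 2d ∫ |A|_∞ ‖∇u‖² h² dμ + 2d² ∫ |C|_∞² Φ_A⁻¹ ‖∇u‖² h² dμ + ∫ ‖B̄‖ ‖∇u‖ h² u dμ`
in `[0,∞]`. -/
theorem stmt4 {d : ℕ} (hd : 2 ≤ d)
    (ρ : EuclideanSpace ℝ (Fin d) → ℝ) (hρc : Continuous ρ) (hρ : ∀ x, 0 < ρ x)
    (μ : Measure (EuclideanSpace ℝ (Fin d)))
    (hμ : μ = volume.withDensity fun x => ENNReal.ofReal (ρ x))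
    (A C : EuclideanSpace ℝ (Fin d) → Matrix (Fin d) (Fin d) ℝ)
    (hAc : ∀ i j, Continuous fun x => A x i j)
    (hAsymm : ∀ x, (A x).IsSymm) (hApos : ∀ x, (A x).PosDef)
    (hCc : ∀ i j, Continuous fun x => C x i j)
    (hCanti : ∀ x, (C x).transpose = -(C x))
    (Bb : EuclideanSpace ℝ (Fin d) → EuclideanSpace ℝ (Fin d))
    (hBmeas : Measurable Bb)
    (hBloc : LocallyIntegrable (fun x => ‖Bb x‖) μ)
    (hBdiv : ∀ f : EuclideanSpace ℝ (Fin d) → ℝ, (∃ K, LipschitzWith K f) →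
      HasCompactSupport f → ∫ x, ⟪Bb x, gradient f x⟫ ∂μ = 0)
    (h : EuclideanSpace ℝ (Fin d) → ℝ) (hh1 : ContDiff ℝ 1 h)
    (hhb : ∃ M, ∀ x, |h x| ≤ M)
    (hres : WeakResolvent μ A C Bb h) :
    ∀ u : EuclideanSpace ℝ (Fin d) → ℝ,
      (∃ K, LipschitzWith K u) → HasCompactSupport u →
      (∀ x, 0 ≤ u x ∧ u x ≤ 1) →
      (∫⁻ x, ENNReal.ofReal (u x ^ 2 * h x ^ 2) ∂μ)
        + (1/4 : ℝ≥0∞) * (∫⁻ x, ENNReal.ofReal (PhiA (A x) * ‖gradient h x‖ ^ 2 * u x ^ 2) ∂μ)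
      ≤ (2 * d : ℝ≥0∞) *
          (∫⁻ x, ENNReal.ofReal (matSup (A x) * ‖gradient u x‖ ^ 2 * h x ^ 2) ∂μ)
        + (2 * d ^ 2 : ℝ≥0∞) *
          (∫⁻ x, ENNReal.ofReal (matSup (C x) ^ 2 * (PhiA (A x))⁻¹ * ‖gradient u x‖ ^ 2 * h x ^ 2) ∂μ)
        + (∫⁻ x, ENNReal.ofReal (‖Bb x‖ * ‖gradient u x‖ * h x ^ 2 * u x) ∂μ) := by
  rintro u ⟨K, hu⟩ huc hu01
  obtain ⟨M, hM⟩ := hhb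
  have : IsLocallyFiniteMeasure μ := hμ ▸ IsLocallyFiniteMeasure.withDensity_ofReal hρc
  have hac : μ ≪ volume := hμ ▸ withDensity_absolutelyContinuous _ _
  have hdiff : ∀ᵐ x ∂μ, DifferentiableAt ℝ u x := hac hu.ae_differentiableAt
  have hhL : LocallyLipschitz h := hh1.locallyLipschitz
  obtain ⟨K₁, hv⟩ := hu.exists_mul_of_hasCompactSupport huc hu.locallyLipschitz
  have hvc : HasCompactSupport fun x => u x * u x := huc.mul_right
  obtain ⟨K₂, hφ⟩ := hv.exists_mul_of_hasCompactSupport hvc hhL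
  have hφc : HasCompactSupport fun x => u x * u x * h x := hvc.mul_right
  obtain ⟨K₃, hψ⟩ := hφ.exists_mul_of_hasCompactSupport hφc hhL
  have hψc : HasCompactSupport fun x => u x * u x * h x * h x := hφc.mul_right
  have hres' := hres _ ⟨K₂, hφ⟩ hφc
  have hdiv' := hBdiv _ ⟨K₃, hψ⟩ hψc
  have hi₁ := integrable_mdot_gradient (μ := μ) (M := fun x => A x + C x)
    (fun i j => (hAc i j).add (hCc i j)) hφ hφc hh1
  have hi₂ := integrable_inner_gradient_mul hBmeas hBloc hφ hφc hh1.continuous.measurable hM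
  have hi₃ : Integrable (fun x => u x * u x * h x * h x) μ :=
    hψ.continuous.integrable_of_hasCompactSupport hψc
  have hi₄ : Integrable
      (fun x => ⟪Bb x, gradient (fun x => u x * u x * h x * h x) x⟫) μ := by
    simpa using integrable_inner_gradient_mul (k := fun _ => 1) (c := 1) hBmeas hBloc hψ hψc
      measurable_const (by simp)
  have hi₁₂ := (hi₁.const_mul (1 / 2)).fun_add hi₂
  have hi₁₂₃ := hi₁₂.fun_add hi₃
  have hE := hi₁₂₃.sub (hi₄.const_mul (1 / 2))
  have hE0 : ∫ x, (1 / 2 * mdot (A x + C x) (gradient (fun x => u x * u x * h x) x) (gradient h x)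
      + ⟪Bb x, gradient (fun x => u x * u x * h x) x⟫ * h x + u x * u x * h x * h x
      - 1 / 2 * ⟪Bb x, gradient (fun x => u x * u x * h x * h x) x⟫) ∂μ = 0 := by
    rw [integral_sub hi₁₂₃ (hi₄.const_mul (1 / 2)), integral_add hi₁₂ hi₃,
      integral_add (hi₁.const_mul (1 / 2)) hi₂, integral_const_mul, integral_const_mul, hdiv',
      mul_zero, sub_zero]
    exact hres'
  have hd0 : 0 < d := by omega
  have hΦ : ∀ x, 0 < PhiA (A x) := fun x => PhiA_pos hd0 (hApos x)
  have hsupA : ∀ x, 0 ≤ matSup (A x) := fun x => matSup_nonneg _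
  have hu0 : ∀ x, 0 ≤ u x := fun x => (hu01 x).1
  have hpt : ∀ᵐ x ∂μ, u x ^ 2 * h x ^ 2 + 1 / 4 * (PhiA (A x) * ‖gradient h x‖ ^ 2 * u x ^ 2)
      ≤ (1 / 2 * mdot (A x + C x) (gradient (fun x => u x * u x * h x) x) (gradient h x)
      + ⟪Bb x, gradient (fun x => u x * u x * h x) x⟫ * h x + u x * u x * h x * h x
      - 1 / 2 * ⟪Bb x, gradient (fun x => u x * u x * h x * h x) x⟫)
      + (2 * d * (matSup (A x) * ‖gradient u x‖ ^ 2 * h x ^ 2)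
      + 2 * d ^ 2 * (matSup (C x) ^ 2 * (PhiA (A x))⁻¹ * ‖gradient u x‖ ^ 2 * h x ^ 2)
      + ‖Bb x‖ * ‖gradient u x‖ * h x ^ 2 * u x) := by
    filter_upwards [hdiff] with x hx
    have hgu := hx.hasGradientAt
    have hgh := (hh1.differentiable one_ne_zero x).hasGradientAt
    have hgφ := (hgu.mul_real hgu).mul_real hgh
    have hgψ := hgφ.mul_real hgh
    have hgφ' : gradient (fun x => u x * u x * h x) x
        = (2 * u x * h x) • gradient u x + (u x ^ 2) • gradient h x := by
      rw [hgφ.gradient]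
      module
    have hgψ' : gradient (fun x => u x * u x * h x * h x) x
        = (2 * u x * h x ^ 2) • gradient u x + (2 * u x ^ 2 * h x) • gradient h x := by
      rw [hgψ.gradient]
      module
    rw [hgφ', hgψ']
    exact caccioppoli_pointwise hd0 (hAsymm x) (hApos x) (hCanti x) (Bb x) (gradient u x)
      (gradient h x) (hu0 x) (h x)
  have key := lintegral_ofReal_le_of_integral_eq_zero hE hE0
    (fun x => by have := hΦ x; positivity)
    (fun x => by have := hΦ x; have := hsupA x; have := hu0 x; positivity) hpt
  have hmu := hu.continuous.measurable
  have hmh := hh1.continuous.measurable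
  have hmgu := measurable_gradient u
  have hmA : Measurable fun x => matSup (A x) := measurable_matSup fun i j => (hAc i j).measurable
  have hl : ∀ x, ENNReal.ofReal
      (u x ^ 2 * h x ^ 2 + 1 / 4 * (PhiA (A x) * ‖gradient h x‖ ^ 2 * u x ^ 2))
      = ENNReal.ofReal (u x ^ 2 * h x ^ 2)
        + 1 / 4 * ENNReal.ofReal (PhiA (A x) * ‖gradient h x‖ ^ 2 * u x ^ 2) := fun x => by
    have := hΦ x
    rw [ENNReal.ofReal_add (by positivity) (by positivity), ENNReal.ofReal_mul (p := 1 / 4) (by norm_num),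
      ENNReal.ofReal_div_of_pos (by norm_num)]
    norm_num
  have hr : ∀ x, ENNReal.ofReal (2 * d * (matSup (A x) * ‖gradient u x‖ ^ 2 * h x ^ 2)
      + 2 * d ^ 2 * (matSup (C x) ^ 2 * (PhiA (A x))⁻¹ * ‖gradient u x‖ ^ 2 * h x ^ 2)
      + ‖Bb x‖ * ‖gradient u x‖ * h x ^ 2 * u x)
      = 2 * d * ENNReal.ofReal (matSup (A x) * ‖gradient u x‖ ^ 2 * h x ^ 2)
      + 2 * d ^ 2 * ENNReal.ofReal
        (matSup (C x) ^ 2 * (PhiA (A x))⁻¹ * ‖gradient u x‖ ^ 2 * h x ^ 2)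
      + ENNReal.ofReal (‖Bb x‖ * ‖gradient u x‖ * h x ^ 2 * u x) := fun x => by
    have := hΦ x
    have := hsupA x
    have := hu0 x
    rw [ENNReal.ofReal_add (by positivity) (by positivity),
      ENNReal.ofReal_add (by positivity) (by positivity), ENNReal.ofReal_mul (by positivity),
      ENNReal.ofReal_mul (p := 2 * (d : ℝ) ^ 2) (by positivity), ENNReal.ofReal_mul zero_le_two,
      ENNReal.ofReal_mul zero_le_two, ENNReal.ofReal_pow (Nat.cast_nonneg d),
      ENNReal.ofReal_natCast, ENNReal.ofReal_ofNat]
  simp only [hl, hr] at key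
  rw [lintegral_add_left (by fun_prop), lintegral_const_mul' _ _ (by simp),
    lintegral_add_right _ (by fun_prop), lintegral_add_left (by fun_prop),
    lintegral_const_mul' _ _ (by finiteness), lintegral_const_mul' _ _ (by finiteness)] at key
  exact key
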